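/- Let T, K be natural numbers with T ≥ 1 and K ≥ 2, let β and ε be positive real numbers, let γ be a nonzero real number, and let g : ℤ → ℂ → ℂ satisfy: (i) for each t ∈ ℤ, the map z ↦ g(t,z) is continuous; (ii) g(t+T, z) = g(t, z) for all t ∈ ℤ, z ∈ ℂ; (iii) for each t ∈ ℤ, |g(t,z)|/|z|³ → 0 as |z| → ∞. Then there exists a (T,K)-periodic function φ : ℤ × ℤ → ℂ such that for all t, k ∈ ℤ: i·β·(φ(t+1,k) − φ(t−1,k)) + γ·|φ(t,k)|²·φ(t,k) + ε·(φ(t,k+1) − 2φ(t,k) + φ(t,k−1)) = g(t, φ(t,k)). -/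

import Mathlib

/-- A commutative real algebra with a module of odd dimension has a real point. -/
theorem nonempty_algHom_real_of_odd_finrank {A : Type*} [CommRing A] [Algebra ℝ A] (n : ℕ)
    (hn : Odd n) (V : Type*) [AddCommGroup V] [Module ℝ V] [Module A V] [IsScalarTower ℝ A V]
    [FiniteDimensional ℝ V] (hV : Module.finrank ℝ V = n) : Nonempty (A →ₐ[ℝ] ℝ) := by
  induction n using Nat.strong_induction_on generalizing V with
  | _ n ih =>
  have : Nontrivial V := Module.nontrivial_of_finrank_pos (R := ℝ) (hV ▸ hn.pos)
  by_cases hs : IsSimpleModule A V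
  · obtain ⟨I, hI, ⟨e⟩⟩ := isSimpleModule_iff_quot_maximal.mp hs
    let eR : V ≃ₗ[ℝ] A ⧸ I := e.restrictScalars ℝ
    have : FiniteDimensional ℝ (A ⧸ I) := eR.finiteDimensional
    let : Field (A ⧸ I) := Ideal.Quotient.field I
    have hfin : Module.finrank ℝ (A ⧸ I) = n := by rw [← hV, eR.finrank_eq]
    have : Algebra.IsAlgebraic ℝ (A ⧸ I) := Algebra.IsAlgebraic.of_finite ℝ (A ⧸ I)
    rcases Real.nonempty_algEquiv_or (A ⧸ I) with h | h
    · obtain ⟨f⟩ := h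
      exact ⟨(f : (A ⧸ I) →ₐ[ℝ] ℝ).comp (Ideal.Quotient.mkₐ ℝ I)⟩
    · obtain ⟨f⟩ := h
      have h := f.toLinearEquiv.finrank_eq
      rw [hfin, Complex.finrank_real_complex] at h
      subst h
      exact absurd hn (by decide)
  · obtain ⟨W, hW0, hW1⟩ : ∃ W : Submodule A V, W ≠ ⊥ ∧ W ≠ ⊤ := by
      by_contra! h
      exact hs ((isSimpleModule_iff A V).2
        ⟨fun W => or_iff_not_imp_left.2 (h W)⟩)
    let WR : Submodule ℝ V := W.restrictScalars ℝ
    have hsum : Module.finrank ℝ (V ⧸ W) + Module.finrank ℝ W = n := by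
      rw [← hV]; exact WR.finrank_quotient_add_finrank
    have hfW : FiniteDimensional ℝ W := inferInstanceAs (FiniteDimensional ℝ WR)
    have hfQ : FiniteDimensional ℝ (V ⧸ W) := inferInstanceAs (FiniteDimensional ℝ (V ⧸ WR))
    have : Nontrivial W := Submodule.nontrivial_iff_ne_bot.2 hW0
    have : Nontrivial (V ⧸ W) := Submodule.Quotient.nontrivial_iff.2 hW1
    have p1 := Module.finrank_pos (R := ℝ) (M := W)
    have p2 := Module.finrank_pos (R := ℝ) (M := V ⧸ W)
    rcases Nat.even_or_odd (Module.finrank ℝ W) with h | h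
    · refine ih _ (by omega) ?_ (V ⧸ W) rfl
      rw [← hsum] at hn
      exact Nat.odd_add.1 hn |>.2 h
    · exact ih _ (by omega) h W rfl

namespace MvPolynomial

variable {σ : Type*}

/-- Real polynomials all of whose monomials have total degree less than `n`. -/
noncomputable def degreeLT (σ : Type*) (n : ℕ) : Submodule ℝ (MvPolynomial σ ℝ) :=
  restrictSupport ℝ {s | s.degree < n}

theorem degreeLT_mono {a b : ℕ} (h : a ≤ b) : degreeLT σ a ≤ degreeLT σ b :=
  restrictSupport_mono ℝ fun _ hs => lt_of_lt_of_le hs h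

theorem degreeLT_zero : degreeLT σ 0 = ⊥ := by
  rw [eq_bot_iff]
  intro q hq
  rw [degreeLT, mem_restrictSupport_iff] at hq
  rw [Submodule.mem_bot, ← support_eq_empty, Finset.eq_empty_iff_forall_notMem]
  intro s hs
  exact Nat.not_lt_zero _ (hq hs)

theorem monomial_mem_degreeLT {c : σ →₀ ℕ} {n : ℕ} (h : c.degree < n) :
    monomial c (1 : ℝ) ∈ degreeLT σ n :=
  (monomial_mem_restrictSupport ℝ).2 (Or.inl h)

theorem mul_mem_degreeLT {a b : ℕ} {p q : MvPolynomial σ ℝ} (hp : p ∈ degreeLT σ a)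
    (hq : q ∈ degreeLT σ (b + 1)) : p * q ∈ degreeLT σ (a + b) := by
  have h : p * q ∈ degreeLT σ a * degreeLT σ (b + 1) := Submodule.mul_mem_mul hp hq
  rw [degreeLT, degreeLT, ← restrictSupport_add] at h
  refine restrictSupport_mono ℝ ?_ h
  rintro _ ⟨s, hs, t, ht, rfl⟩
  simp only [Set.mem_ofPred_eq, map_add] at *
  omega

/-- `q` has leading monomial `c`, with respect to the total degree. -/
def IsMonicAt (q : MvPolynomial σ ℝ) (c : σ →₀ ℕ) : Prop :=
  q - monomial c 1 ∈ degreeLT σ c.degree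

theorem IsMonicAt.mem {q : MvPolynomial σ ℝ} {c : σ →₀ ℕ} (h : IsMonicAt q c) :
    q ∈ degreeLT σ (c.degree + 1) := by
  rw [← sub_add_cancel q (monomial c 1)]
  exact add_mem (degreeLT_mono (Nat.le_succ _) h) (monomial_mem_degreeLT (Nat.lt_succ_self _))

theorem isMonicAt_monomial (c : σ →₀ ℕ) : IsMonicAt (monomial c 1) c := by
  simp [IsMonicAt]

theorem isMonicAt_one : IsMonicAt (1 : MvPolynomial σ ℝ) 0 := isMonicAt_monomial 0

theorem IsMonicAt.mul {q r : MvPolynomial σ ℝ} {c d : σ →₀ ℕ} (hq : IsMonicAt q c)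
    (hr : IsMonicAt r d) : IsMonicAt (q * r) (c + d) := by
  have h : q * r - monomial (c + d) 1 =
      (q - monomial c 1) * r + (r - monomial d 1) * monomial c 1 := by
    rw [show (monomial (c + d) (1 : ℝ)) = monomial c 1 * monomial d 1 by simp [monomial_mul]]
    ring
  rw [IsMonicAt, h, map_add]
  refine add_mem (mul_mem_degreeLT hq hr.mem) ?_
  rw [add_comm]
  exact mul_mem_degreeLT hr (monomial_mem_degreeLT (Nat.lt_succ_self _))

theorem IsMonicAt.pow {q : MvPolynomial σ ℝ} {c : σ →₀ ℕ} (hq : IsMonicAt q c) (n : ℕ) :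
    IsMonicAt (q ^ n) (n • c) := by
  induction n with
  | zero => simpa using isMonicAt_one
  | succ n ih => rw [pow_succ, succ_nsmul]; exact ih.mul hq

theorem IsMonicAt.prod {ι : Type*} (s : Finset ι) {q : ι → MvPolynomial σ ℝ} {c : ι → σ →₀ ℕ}
    (h : ∀ i ∈ s, IsMonicAt (q i) (c i)) : IsMonicAt (∏ i ∈ s, q i) (∑ i ∈ s, c i) := by
  classical
  induction s using Finset.induction_on with
  | empty => simpa using isMonicAt_one
  | insert a s ha ih =>
    rw [Finset.prod_insert ha, Finset.sum_insert ha]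
    exact (h a (Finset.mem_insert_self a s)).mul
      (ih fun i hi => h i (Finset.mem_insert_of_mem hi))

section LinearMap

variable {Φ : MvPolynomial σ ℝ →ₗ[ℝ] MvPolynomial σ ℝ}

theorem map_sub_self_mem_degreeLT (hΦ : ∀ c, IsMonicAt (Φ (monomial c 1)) c) {n : ℕ}
    {q : MvPolynomial σ ℝ} (hq : q ∈ degreeLT σ (n + 1)) : Φ q - q ∈ degreeLT σ n := by
  rw [degreeLT, mem_restrictSupport_iff] at hq
  have h : Φ q - q = ∑ s ∈ q.support, q.coeff s • (Φ (monomial s 1) - monomial s 1) := by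
    simp only [smul_sub, Finset.sum_sub_distrib, ← map_smul, ← map_sum]
    simp only [smul_eq_mul, mul_one, support_sum_monomial_coeff]
  rw [h]
  refine sum_mem fun s hs => Submodule.smul_mem _ _ ?_
  exact degreeLT_mono (Nat.lt_succ_iff.1 (hq hs)) (hΦ s)

theorem exists_mem_degreeLT (q : MvPolynomial σ ℝ) : ∃ n, q ∈ degreeLT σ n := by
  refine ⟨q.totalDegree + 1, ?_⟩
  rw [degreeLT, mem_restrictSupport_iff]
  intro s hs
  exact Nat.lt_succ_of_le (le_totalDegree hs)

theorem bijective_of_isMonicAt (hΦ : ∀ c, IsMonicAt (Φ (monomial c 1)) c) :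
    Function.Bijective Φ := by
  constructor
  · rw [injective_iff_map_eq_zero]
    intro q hq
    obtain ⟨n, hn⟩ := exists_mem_degreeLT q
    induction n with
    | zero => simpa [degreeLT_zero] using hn
    | succ n ih =>
      have := map_sub_self_mem_degreeLT hΦ hn
      rw [hq, zero_sub, neg_mem_iff] at this
      exact ih this
  · intro q
    obtain ⟨n, hn⟩ := exists_mem_degreeLT q
    induction n generalizing q with
    | zero => exact ⟨0, by rw [degreeLT_zero, Submodule.mem_bot] at hn; rw [hn, map_zero]⟩
    | succ n ih =>
      obtain ⟨r, hr⟩ := ih _ (map_sub_self_mem_degreeLT hΦ hn)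
      exact ⟨q - r, by rw [map_sub, hr, sub_sub_cancel]⟩

end LinearMap

/-- The products of the powers of `f i` with the monomials of exponents less than `m`. -/
noncomputable def divPowProd [Fintype σ] (m : ℕ) (f : σ → MvPolynomial σ ℝ) (c : σ →₀ ℕ) :
    MvPolynomial σ ℝ :=
  ∏ i, X i ^ (c i % m) * f i ^ (c i / m)

theorem isMonicAt_divPowProd [Fintype σ] {m : ℕ} {f : σ → MvPolynomial σ ℝ}
    (hf : ∀ i, IsMonicAt (f i) (Finsupp.single i m)) (c : σ →₀ ℕ) :
    IsMonicAt (divPowProd m f c) c := by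
  have h : ∑ i, ((c i % m) • Finsupp.single i 1 + (c i / m) • Finsupp.single i m) = c := by
    classical
    ext j
    simp only [Finsupp.coe_finsetSum, Finset.sum_apply, Finsupp.add_apply, Finsupp.smul_apply,
      Finsupp.single_apply, smul_eq_mul, mul_ite, mul_zero, mul_one]
    rw [Finset.sum_eq_single j (by intro b _ hb; simp [hb]) (by simp)]
    simpa using Nat.mod_add_div' (c j) m
  have := IsMonicAt.prod Finset.univ fun i _ =>
    ((isMonicAt_monomial (Finsupp.single i 1)).pow (c i % m)).mul ((hf i).pow (c i / m))
  rwa [h] at this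

theorem mul_divPowProd [Fintype σ] {m : ℕ} (hm : 0 < m) (f : σ → MvPolynomial σ ℝ) (i : σ)
    (c : σ →₀ ℕ) : f i * divPowProd m f c = divPowProd m f (c + Finsupp.single i m) := by
  classical
  rw [divPowProd, divPowProd, ← Finset.mul_prod_erase _ _ (Finset.mem_univ i),
    ← Finset.mul_prod_erase _ _ (Finset.mem_univ i), ← mul_assoc]
  congr 1
  · simp [Nat.add_div_right _ hm, pow_succ]; ring
  · refine Finset.prod_congr rfl fun j hj => ?_
    simp [(Finset.ne_of_mem_erase hj).symm]

theorem divPowProd_mem_span [Fintype σ] {m : ℕ} (hm : 0 < m) (f : σ → MvPolynomial σ ℝ)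
    {i : σ} {c : σ →₀ ℕ} (h : m ≤ c i) : divPowProd m f c ∈ Ideal.span (Set.range f) := by
  classical
  refine Ideal.mem_of_dvd _ ?_ (Ideal.subset_span ⟨i, rfl⟩)
  refine dvd_trans ?_ (Finset.dvd_prod_of_mem _ (Finset.mem_univ i))
  exact dvd_mul_of_dvd_right (dvd_pow_self _ (Nat.div_pos h hm).ne') _

theorem nonempty_quotient_span_linearEquiv [Fintype σ] {m : ℕ} (hm : 0 < m) {f : σ → MvPolynomial σ ℝ}
    (hf : ∀ i, IsMonicAt (f i) (Finsupp.single i m)) :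
    Nonempty ((MvPolynomial σ ℝ ⧸ Ideal.span (Set.range f)) ≃ₗ[ℝ] ((σ → Fin m) → ℝ)) := by
  classical
  let Φ : MvPolynomial σ ℝ →ₗ[ℝ] MvPolynomial σ ℝ :=
    (basisMonomials σ ℝ).constr ℝ (divPowProd m f)
  have hΦ (c) : Φ (monomial c 1) = divPowProd m f c := by
    have := (basisMonomials σ ℝ).constr_basis ℝ (divPowProd m f) c
    simpa using this
  have hbij : Function.Bijective Φ :=
    bijective_of_isMonicAt fun c => by rw [hΦ]; exact isMonicAt_divPowProd hf c
  let b : Module.Basis (σ →₀ ℕ) ℝ (MvPolynomial σ ℝ) :=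
    (basisMonomials σ ℝ).map (LinearEquiv.ofBijective Φ hbij)
  have hb (c) : b c = divPowProd m f c := by simp [b, hΦ]
  let toExp : (σ → Fin m) → (σ →₀ ℕ) := fun a => Finsupp.equivFunOnFinite.symm fun i => a i
  have toExp_inj : Function.Injective toExp := by
    intro a a' h
    funext i
    have := DFunLike.congr_fun h i
    exact Fin.ext this
  let ψ : MvPolynomial σ ℝ →ₗ[ℝ] ((σ → Fin m) → ℝ) :=
    LinearMap.pi fun a => b.coord (toExp a)
  have hψ (q a) : ψ q a = b.repr q (toExp a) := rfl
  have hsurj : Function.Surjective ψ := by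
    intro v
    refine ⟨∑ a, v a • b (toExp a), ?_⟩
    funext a
    rw [hψ, map_sum, Finsupp.finsetSum_apply, Finset.sum_eq_single a]
    · simp
    · intro a' _ h
      simp [toExp_inj.ne h]
    · simp
  have hker : LinearMap.ker ψ = (Ideal.span (Set.range f)).restrictScalars ℝ := by
    apply le_antisymm
    · intro q hq
      rw [Submodule.restrictScalars_mem, ← b.linearCombination_repr q,
        Finsupp.linearCombination_apply]
      refine sum_mem fun c hc => Submodule.smul_of_tower_mem _ _ ?_
      rw [hb]
      by_contra hmem
      have hlt (i) : c i < m := by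
        by_contra! h
        exact hmem (divPowProd_mem_span hm f h)
      have h0 := congrFun (LinearMap.mem_ker.1 hq) fun i => ⟨c i, hlt i⟩
      rw [hψ, show toExp (fun i => ⟨c i, hlt i⟩) = c from Finsupp.ext fun _ => rfl] at h0
      exact Finsupp.mem_support_iff.1 hc h0
    · have key (i : σ) (q : MvPolynomial σ ℝ) : ψ (q * f i) = 0 := by
        have : ψ ∘ₗ LinearMap.mulRight ℝ (f i) = 0 := by
          refine b.ext fun c => ?_
          funext a
          simp only [LinearMap.comp_apply, LinearMap.mulRight_apply, LinearMap.zero_apply,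
            Pi.zero_apply]
          rw [hb, mul_comm, mul_divPowProd hm, ← hb, hψ, b.repr_self, Finsupp.single_apply,
            if_neg]
          intro h
          have := DFunLike.congr_fun h i
          have h2 : (toExp a) i < m := (a i).2
          simp only [Finsupp.add_apply, Finsupp.single_eq_same] at this
          omega
        exact LinearMap.congr_fun this q
      intro q hq
      rw [Submodule.restrictScalars_mem] at hq
      obtain ⟨r, rfl⟩ := (Ideal.mem_span_range_iff_exists_fun).1 hq
      rw [LinearMap.mem_ker, map_sum]
      exact Finset.sum_eq_zero fun i _ => key i _
  let e := ψ.quotKerEquivOfSurjective hsurj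
  rw [hker] at e
  exact ⟨e⟩

/-- A square real polynomial system with leading parts `X i ^ m`, `m` odd, has a real zero. -/
theorem exists_pow_add_eval_eq_zero [Fintype σ] {m : ℕ} (hm : Odd m)
    (p : σ → MvPolynomial σ ℝ) (hp : ∀ i, (p i).totalDegree < m) :
    ∃ x : σ → ℝ, ∀ i, x i ^ m + eval x (p i) = 0 := by
  classical
  let f : σ → MvPolynomial σ ℝ := fun i => X i ^ m + p i
  have hf (i) : IsMonicAt (f i) (Finsupp.single i m) := by
    rw [IsMonicAt, ← X_pow_eq_monomial, add_sub_cancel_left, Finsupp.degree_single,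
      degreeLT, mem_restrictSupport_iff]
    intro s hs
    exact lt_of_le_of_lt (le_totalDegree hs) (hp i)
  obtain ⟨e⟩ := nonempty_quotient_span_linearEquiv hm.pos hf
  have hfin : FiniteDimensional ℝ (MvPolynomial σ ℝ ⧸ Ideal.span (Set.range f)) :=
    e.symm.finiteDimensional
  have hodd : Odd (Module.finrank ℝ (MvPolynomial σ ℝ ⧸ Ideal.span (Set.range f))) := by
    rw [e.finrank_eq]
    simpa using hm.pow
  obtain ⟨φ⟩ := nonempty_algHom_real_of_odd_finrank
    (A := MvPolynomial σ ℝ ⧸ Ideal.span (Set.range f)) _ hodd _ rfl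
  let χ : MvPolynomial σ ℝ →ₐ[ℝ] ℝ := φ.comp (Ideal.Quotient.mkₐ ℝ _)
  refine ⟨fun i => χ (X i), fun i => ?_⟩
  have h0 : χ (f i) = 0 := by
    have : Ideal.Quotient.mk (Ideal.span (Set.range f)) (f i) = 0 :=
      Ideal.Quotient.eq_zero_iff_mem.2 (Ideal.subset_span ⟨i, rfl⟩)
    simp [χ, this]
  have h1 : eval (fun i => χ (X i)) (f i) = χ (f i) := by
    rw [← MvPolynomial.coe_aeval_eq_eval]
    exact DFunLike.congr_fun (aeval_unique χ).symm (f i)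
  rw [h0] at h1
  simpa [f] using h1

theorem exists_abs_eval_le_mul_pow (q : MvPolynomial σ ℝ) :
    ∃ (C : ℝ) (d : ℕ), 0 ≤ C ∧ ∀ (x : σ → ℝ) (s : ℝ), 1 ≤ s → (∀ j, |x j| ≤ s) →
      |eval x q| ≤ C * s ^ d := by
  induction q using MvPolynomial.induction_on with
  | C a => exact ⟨|a|, 0, abs_nonneg a, fun x s _ _ => by simp⟩
  | add p q hp hq =>
    obtain ⟨C, d, hC, h⟩ := hp
    obtain ⟨C', d', hC', h'⟩ := hq
    refine ⟨C + C', max d d', by positivity, fun x s hs hx => ?_⟩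
    rw [map_add, add_mul]
    refine (abs_add_le _ _).trans (add_le_add ((h x s hs hx).trans ?_) ((h' x s hs hx).trans ?_))
    · gcongr
      exact le_max_left _ _
    · gcongr
      exact le_max_right _ _
  | mul_X p i hp =>
    obtain ⟨C, d, hC, h⟩ := hp
    refine ⟨C, d + 1, hC, fun x s hs hx => ?_⟩
    rw [map_mul, eval_X, abs_mul, pow_succ, ← mul_assoc]
    exact mul_le_mul (h x s hs hx) (hx i) (abs_nonneg _) (by positivity)

theorem eventually_abs_eval_lt (q : MvPolynomial σ ℝ) {η : ℝ} (hη : 0 < η) :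
    ∀ᶠ m : ℕ in Filter.atTop, ∀ (x : σ → ℝ) (s : ℝ), 2 ≤ s → (∀ j, |x j| ≤ s) →
      |eval x q| < η * s ^ m := by
  obtain ⟨C, d, hC, h⟩ := exists_abs_eval_le_mul_pow q
  obtain ⟨k, hk⟩ := pow_unbounded_of_one_lt (C / η) (one_lt_two (α := ℝ))
  rw [div_lt_iff₀' hη] at hk
  filter_upwards [Filter.eventually_ge_atTop (k + d)] with m hm x s hs hx
  have hs0 : 0 < s := by linarith
  calc |eval x q| ≤ C * s ^ d := h x s (by linarith) hx
    _ < (η * 2 ^ k) * s ^ d := by gcongr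
    _ ≤ (η * s ^ k) * s ^ d := by gcongr
    _ = η * s ^ (k + d) := by rw [pow_add, mul_assoc]
    _ ≤ η * s ^ m := by gcongr; linarith

theorem exists_forall_abs_eval_sub_lt {f : (σ → ℝ) → ℝ} (hf : Continuous f) {K : Set (σ → ℝ)}
    (hK : IsCompact K) {η : ℝ} (hη : 0 < η) :
    ∃ q : MvPolynomial σ ℝ, ∀ x ∈ K, |eval x q - f x| < η := by
  let ev : MvPolynomial σ ℝ →ₐ[ℝ] C(σ → ℝ, ℝ) := aeval fun i => ⟨fun x => x i, continuous_apply i⟩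
  have hev (q : MvPolynomial σ ℝ) (x : σ → ℝ) : ev q x = eval x q := by
    induction q using MvPolynomial.induction_on with
    | C a => simp [ev]
    | add p q hp hq => simp [hp, hq]
    | mul_X p i hp => rw [map_mul, ContinuousMap.mul_apply, hp]; simp [ev]
  have hsep : ev.range.SeparatesPoints := by
    intro x y hxy
    obtain ⟨i, hi⟩ := Function.ne_iff.1 hxy
    refine ⟨_, ⟨ev (X i), ⟨X i, rfl⟩, rfl⟩, ?_⟩
    simpa [ev] using hi
  obtain ⟨_, ⟨q, rfl⟩, hq⟩ :=
    ContinuousMap.exists_mem_subalgebra_near_continuous_of_isCompact_of_separatesPoints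
      hsep ⟨f, hf⟩ hK hη
  refine ⟨q, fun x hx => ?_⟩
  have := hq x hx
  rw [Real.norm_eq_abs] at this
  rw [← hev]
  exact this

end MvPolynomial

theorem exists_forall_abs_le_of_mul_nonneg {σ : Type*} [Finite σ] {f : (σ → ℝ) → σ → ℝ}
    (hf : Continuous f)
    (h : ∀ x i, (∀ j, |x j| ≤ |x i|) → 1 ≤ |x i| → 0 ≤ f x i * x i) {δ : ℝ} (hδ : 0 < δ) :
    ∃ x : σ → ℝ, (∀ j, |x j| ≤ 1) ∧ ∀ i, |f x i| ≤ δ := by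
  have := Fintype.ofFinite σ
  obtain ⟨η, hη, rfl⟩ : ∃ η : ℝ, 0 < η ∧ 4 * η = δ := ⟨δ / 4, by positivity, by ring⟩
  have hK : IsCompact (Set.univ.pi fun _ : σ => Set.Icc (-2 : ℝ) 2) :=
    isCompact_univ_pi fun _ => isCompact_Icc
  choose P hP using fun i => MvPolynomial.exists_forall_abs_eval_sub_lt
    (f := fun x => f x i + 2 * η * x i) (by fun_prop) hK hη
  have hP' (x : σ → ℝ) (hx : ∀ j, |x j| ≤ 2) (i : σ) :
      |MvPolynomial.eval x (P i) - (f x i + 2 * η * x i)| < η :=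
    hP i x fun j _ => abs_le.1 (hx j)
  obtain ⟨m, hm, hdeg, hgrow⟩ : ∃ m : ℕ, Odd m ∧ (∀ i, (P i).totalDegree < m) ∧
      ∀ i, ∀ (x : σ → ℝ) (s : ℝ), 2 ≤ s → (∀ j, |x j| ≤ s) →
        |MvPolynomial.eval x (P i)| < η * s ^ m := by
    have h1 : ∀ᶠ m : ℕ in Filter.atTop, ∀ i, (P i).totalDegree < m :=
      Filter.eventually_all.2 fun i => Filter.eventually_gt_atTop _
    have h2 := Filter.eventually_all.2 fun i =>
      MvPolynomial.eventually_abs_eval_lt (P i) hη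
    exact (Nat.frequently_odd.and_eventually (h1.and h2)).exists
  obtain ⟨x, hx⟩ := MvPolynomial.exists_pow_add_eval_eq_zero hm
    (fun i => MvPolynomial.C η⁻¹ * P i) fun i =>
      (MvPolynomial.totalDegree_mul _ _).trans_lt (by simpa using hdeg i)
  have hx' (i) : MvPolynomial.eval x (P i) = -(η * x i ^ m) := by
    have := hx i
    rw [map_mul, MvPolynomial.eval_C] at this
    field_simp at this
    linarith
  have hx1 : ∀ j, |x j| ≤ 1 := by
    by_contra! hlt
    obtain ⟨j, hj⟩ := hlt
    have : Nonempty σ := ⟨j⟩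
    obtain ⟨i, hi⟩ := Finite.exists_max fun j => |x j|
    have hi1 : 1 < |x i| := hj.trans_le (hi j)
    rcases le_total (|x i|) 2 with hi2 | hi2
    · have hA := hP' x (fun j => (hi j).trans hi2) i
      have hB := h x i hi hi1.le
      have hC : 0 ≤ x i ^ (m + 1) := hm.add_one.pow_nonneg _
      rw [hx'] at hA
      have hD : |(-(η * x i ^ m) - (f x i + 2 * η * x i)) * x i| ≤ η * |x i| := by
        rw [abs_mul]
        gcongr
      have hE := (abs_le.1 hD).1
      rw [pow_succ] at hC
      have hF : η * |x i| < η * (x i * x i) := by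
        rw [← abs_mul_abs_self (x i)]
        gcongr
        nlinarith
      nlinarith [mul_nonneg hη.le hC]
    · have := hgrow i x _ hi2 hi
      rw [hx', abs_neg, abs_mul, abs_of_pos hη, abs_pow] at this
      exact lt_irrefl _ this
  refine ⟨x, hx1, fun i => ?_⟩
  have hA := abs_lt.1 (hP' x (fun j => (hx1 j).trans one_le_two) i)
  have hB : |x i ^ m| ≤ 1 := by rw [abs_pow]; exact pow_le_one₀ (abs_nonneg _) (hx1 i)
  have hB' := abs_le.1 hB
  have hC := abs_le.1 (hx1 i)
  rw [hx'] at hA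
  rw [abs_le]
  constructor <;> nlinarith

/-- A form of the Poincaré-Miranda theorem: a continuous vector field that points outwards at
every maximal coordinate, outside of a cube, has a zero. -/
theorem exists_eq_zero_of_mul_nonneg {σ : Type*} [Finite σ] {f : (σ → ℝ) → σ → ℝ}
    (hf : Continuous f) {R : ℝ} (hR : 0 < R)
    (h : ∀ x i, (∀ j, |x j| ≤ |x i|) → R ≤ |x i| → 0 ≤ f x i * x i) :
    ∃ x, f x = 0 := by
  have := Fintype.ofFinite σ
  let F : (σ → ℝ) → σ → ℝ := fun y => f (R • y)
  have hF : Continuous F := by fun_prop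
  have hFsign (y : σ → ℝ) (i : σ) (hi : ∀ j, |y j| ≤ |y i|) (h1 : 1 ≤ |y i|) :
      0 ≤ F y i * y i := by
    have := h (R • y) i
    simp only [Pi.smul_apply, smul_eq_mul, abs_mul, abs_of_pos hR] at this
    have := this (fun j => mul_le_mul_of_nonneg_left (hi j) hR.le) (by nlinarith)
    rw [mul_left_comm] at this
    exact nonneg_of_mul_nonneg_right this hR
  have hK : IsCompact (Set.univ.pi fun _ : σ => Set.Icc (-1 : ℝ) 1) :=
    isCompact_univ_pi fun _ => isCompact_Icc
  obtain ⟨y, -, hy⟩ := hK.exists_isMinOn ⟨0, fun j _ => by simp⟩ hF.norm.continuousOn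
  refine ⟨R • y, ?_⟩
  change F y = 0
  by_contra hne
  have hpos : 0 < ‖F y‖ := norm_pos_iff.2 hne
  obtain ⟨z, hz1, hz⟩ := exists_forall_abs_le_of_mul_nonneg hF hFsign (half_pos hpos)
  have h1 : ‖F y‖ ≤ ‖F z‖ := isMinOn_iff.1 hy z fun j _ => abs_le.1 (hz1 j)
  have h2 : ‖F z‖ ≤ ‖F y‖ / 2 := (pi_norm_le_iff_of_nonneg (half_pos hpos).le).2 hz
  linarith

theorem exists_cubic_system_solution {ι : Type*} [Finite ι] (e₁ e₂ : ι → ι) {β γ : ℝ}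
    (hβ : 0 < β) (hγ : γ ≠ 0) {G : ι → ℂ → ℂ} (hcont : ∀ a, Continuous (G a))
    (hsub : ∀ a, ∀ δ > (0 : ℝ), ∃ R > (0 : ℝ), ∀ z : ℂ, R ≤ ‖z‖ → ‖G a z‖ ≤ δ * ‖z‖ ^ 3) :
    ∃ z : ι → ℂ, ∀ a, Complex.I * (β : ℂ) * (z (e₁ a) - z (e₂ a)) +
      ((γ * ‖z a‖ ^ 2 : ℝ) : ℂ) * z a = G a (z a) := by
  have := Fintype.ofFinite ι
  have hγ' : 0 < |γ| := abs_pos.2 hγ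
  choose r hr0 hr using fun a => hsub a (|γ| / 16) (by positivity)
  let Z : (ι × Bool → ℝ) → ι → ℂ := fun x a => ⟨x (a, false), x (a, true)⟩
  have hZ (a) : Continuous fun x => Z x a := by
    have : (fun x => Z x a) =
        fun x => ((x (a, false) : ℝ) : ℂ) + ((x (a, true) : ℝ) : ℂ) * Complex.I := by
      funext x
      exact Complex.mk_eq_add_mul_I _ _
    rw [this]
    fun_prop
  let W : (ι × Bool → ℝ) → ι → ℂ := fun x a =>
    ((γ⁻¹ : ℝ) : ℂ) * (Complex.I * (β : ℂ) * (Z x (e₁ a) - Z x (e₂ a)) - G a (Z x a))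
  have hW (a) : Continuous fun x => W x a := by
    have h1 := (hcont a).comp (hZ a)
    have h2 := hZ (e₁ a)
    have h3 := hZ (e₂ a)
    exact continuous_const.mul ((continuous_const.mul (h2.sub h3)).sub h1)
  let f : (ι × Bool → ℝ) → ι × Bool → ℝ := fun x p =>
    ‖Z x p.1‖ ^ 2 * x p + bif p.2 then (W x p.1).im else (W x p.1).re
  have hf : Continuous f := by
    refine continuous_pi fun ⟨a, b⟩ => ?_
    have h1 := hZ a
    have h2 := hW a
    cases b
    · exact ((h1.norm.pow 2).mul (continuous_apply _)).add (Complex.continuous_re.comp h2)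
    · exact ((h1.norm.pow 2).mul (continuous_apply _)).add (Complex.continuous_im.comp h2)
  have hsum0 : 0 ≤ ∑ a, r a := Finset.sum_nonneg fun a _ => (hr0 a).le
  have hquot : 0 < β / |γ| := by positivity
  have hR : 0 < 1 + 8 * (β / |γ|) + ∑ a, r a := by positivity
  obtain ⟨x, hx⟩ := exists_eq_zero_of_mul_nonneg hf hR fun x p hmax hp => by
    obtain ⟨a, b⟩ := p
    set s := |x (a, b)| with hs
    have hra : r a ≤ ∑ a, r a :=
      Finset.single_le_sum (fun a _ => (hr0 a).le) (Finset.mem_univ a)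
    have hs1 : 1 ≤ s := by linarith
    have hZle (c) : ‖Z x c‖ ≤ 2 * s := by
      have := Complex.norm_le_abs_re_add_abs_im (Z x c)
      have h1 := hmax (c, false)
      have h2 := hmax (c, true)
      simp only [Z] at this ⊢
      linarith
    have hZge : s ≤ ‖Z x a‖ := by
      cases b
      · exact Complex.abs_re_le_norm (Z x a)
      · exact Complex.abs_im_le_norm (Z x a)
    have hG : ‖G a (Z x a)‖ ≤ |γ| * (s ^ 3 / 2) := by
      calc ‖G a (Z x a)‖ ≤ |γ| / 16 * ‖Z x a‖ ^ 3 := hr a _ (by linarith)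
        _ ≤ |γ| / 16 * (2 * s) ^ 3 := by gcongr; exact hZle a
        _ = |γ| * (s ^ 3 / 2) := by ring
    have hD : ‖Complex.I * (β : ℂ) * (Z x (e₁ a) - Z x (e₂ a))‖ ≤ β * (4 * s) := by
      rw [norm_mul, norm_mul, Complex.norm_I, one_mul, Complex.norm_of_nonneg hβ.le]
      gcongr
      refine (norm_sub_le _ _).trans ?_
      linarith [hZle (e₁ a), hZle (e₂ a)]
    have hWle : ‖W x a‖ ≤ s ^ 3 := by
      have h1 : ‖W x a‖ ≤ |γ|⁻¹ * (β * (4 * s) + |γ| * (s ^ 3 / 2)) := by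
        simp only [W]
        rw [norm_mul, Complex.norm_real, norm_inv, Real.norm_eq_abs]
        gcongr
        exact (norm_sub_le _ _).trans (add_le_add hD hG)
      have h2 : |γ|⁻¹ * (β * (4 * s) + |γ| * (s ^ 3 / 2)) = 4 * (β / |γ|) * s + s ^ 3 / 2 := by
        field_simp
      have h3 : 8 * (β / |γ|) * s ≤ s ^ 2 * s := by
        gcongr
        nlinarith
      rw [h2] at h1
      nlinarith
    have key (w : ℝ) (hw : |w| ≤ ‖W x a‖) : 0 ≤ (‖Z x a‖ ^ 2 * x (a, b) + w) * x (a, b) := by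
      have h1 : |w * x (a, b)| ≤ s ^ 3 * s := by
        rw [abs_mul]
        gcongr
        exact hw.trans hWle
      have h2 : s ^ 2 * (s * s) ≤ ‖Z x a‖ ^ 2 * (s * s) := by gcongr
      have h3 : s * s = x (a, b) * x (a, b) := abs_mul_abs_self _
      have h4 := (abs_le.1 h1).1
      rw [h3] at h2
      have h5 : s ^ 2 * (x (a, b) * x (a, b)) = s ^ 3 * s := by rw [← h3]; ring
      linarith
    cases b
    · exact key _ (Complex.abs_re_le_norm _)
    · exact key _ (Complex.abs_im_le_norm _)
  refine ⟨Z x, fun a => ?_⟩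
  have h0 : ((‖Z x a‖ ^ 2 : ℝ) : ℂ) * Z x a + W x a = 0 := by
    apply Complex.ext
    · rw [Complex.add_re, Complex.re_ofReal_mul]
      exact congrFun hx (a, false)
    · rw [Complex.add_im, Complex.im_ofReal_mul]
      exact congrFun hx (a, true)
  have hγc : (γ : ℂ) ≠ 0 := Complex.ofReal_ne_zero.2 hγ
  simp only [W] at h0
  push_cast at h0 ⊢
  field_simp at h0
  linear_combination h0

/-- Main theorem: existence of a (T,K)-periodic solution of the discrete
nonlinear Schrödinger equation
iβ(φ(t+1,k) − φ(t−1,k)) + γ|φ(t,k)|²φ(t,k)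
  + ε(φ(t,k+1) − 2φ(t,k) + φ(t,k−1)) = g(t, φ(t,k)),
under continuity, T-periodicity in t, and subcubic growth of g. -/
theorem dnls_periodic_solution (T K : ℕ) (hT : 1 ≤ T) (hK : 2 ≤ K)
    (β ε : ℝ) (hβ : 0 < β) (hε : 0 < ε) (γ : ℝ) (hγ : γ ≠ 0)
    (g : ℤ → ℂ → ℂ)
    (hcont : ∀ t : ℤ, Continuous (g t))
    (hper : ∀ (t : ℤ) (z : ℂ), g (t + (T : ℤ)) z = g t z)
    (hsub : ∀ t : ℤ, ∀ δ > (0 : ℝ), ∃ R > (0 : ℝ), ∀ z : ℂ,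
      R ≤ ‖z‖ → ‖g t z‖ ≤ δ * ‖z‖ ^ 3) :
    ∃ φ : ℤ × ℤ → ℂ,
      (∀ t k : ℤ, φ (t + (T : ℤ), k) = φ (t, k)) ∧
      (∀ t k : ℤ, φ (t, k + (K : ℤ)) = φ (t, k)) ∧
      ∀ t k : ℤ,
        Complex.I * (β : ℂ) * (φ (t + 1, k) - φ (t - 1, k)) +
          ((γ * ‖φ (t, k)‖ ^ 2 : ℝ) : ℂ) * φ (t, k) +
          (ε : ℂ) * (φ (t, k + 1) - 2 * φ (t, k) + φ (t, k - 1)) =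
          g t (φ (t, k)) := by
  have : NeZero T := ⟨by omega⟩
  have hcast (t : ℤ) : g ((t : ZMod T).val : ℤ) = g t := by
    have hp : Function.Periodic g (T : ℤ) := fun t => funext (hper t)
    rw [ZMod.val_intCast]
    conv_rhs => rw [← Int.emod_add_mul_ediv t T, mul_comm]
    exact ((hp.int_mul (t / T)) (t % T)).symm
  obtain ⟨z, hz⟩ := exists_cubic_system_solution (fun a : ZMod T => a + 1) (fun a => a - 1) hβ hγ
    (fun a : ZMod T => hcont (a.val : ℤ)) fun a => hsub (a.val : ℤ)
  refine ⟨fun p => z (p.1 : ZMod T), fun t k => by simp, fun t k => rfl, fun t k => ?_⟩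
  have h := hz t
  simp only [hcast] at h
  push_cast at h ⊢
  linear_combination h
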